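/- Let μ be a probability measure on ℝⁿ that is absolutely continuous with respect to Lebesgue measure, let h: ℝⁿ → ℝ be a bounded Lipschitz function with ∫ h dμ = 0 and ‖h‖_∞ := sup_x |h(x)| > 0, and let λ > 0 satisfy λ ∫ h² dμ ≥ ∫ ‖∇h‖² dμ (where ∇h is the almost-everywhere derivative of h, which exists Lebesgue-a.e. and hence μ-a.e. by Rademacher's theorem). Fix ε with 0 < ε < 1/(2‖h‖_∞) and set f := 1 + ε h. Then f > 0 everywhere, ∫ f dμ = 1, and ∫ f log f dμ ≥ ((1 − ε‖h‖_∞)/(1 + ε‖h‖_∞)) · (1/(2λ)) · ∫ (‖∇f‖² / f) dμ. -/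

import Mathlib

open MeasureTheory Real Set

lemma aux_ineq (t a : ℝ) (ha : 0 ≤ a) (h1 : -1 < t) (h2 : t ≤ a) :
    t + t ^ 2 / (2 * (1 + a)) ≤ (1 + t) * Real.log (1 + t) := by
  rcases le_total 0 t with ht | ht
  · have hl := Real.le_log_one_add_of_nonneg ht
    have e : (1 + t) * (2 * t / (t + 2)) = t + t ^ 2 / (t + 2) := by
      field_simp
      ring
    have h3 : t ^ 2 / (2 * (1 + a)) ≤ t ^ 2 / (t + 2) := by
      apply div_le_div_of_nonneg_left (by positivity) (by positivity) (by linarith)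
    have h4 := mul_le_mul_of_nonneg_left hl (by linarith : 0 ≤ 1 + t)
    linarith
  · have hs : 0 < 1 + t := by linarith
    have hx : 0 ≤ Real.log (1 + t)⁻¹ := by
      apply Real.log_nonneg
      exact (one_le_inv₀ hs).2 (by linarith)
    have h3 := Real.self_le_sinh_iff.2 hx
    rw [Real.sinh_log (by positivity), Real.log_inv, inv_inv] at h3
    have h4 := mul_le_mul_of_nonneg_left h3 hs.le
    have e : (1 + t) * (((1 + t)⁻¹ - (1 + t)) / 2) = -(t + t ^ 2 / 2) := by
      field_simp
      ring
    have h5 : t ^ 2 / (2 * (1 + a)) ≤ t ^ 2 / 2 := by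
      apply div_le_div_of_nonneg_left (by positivity) (by positivity) (by linarith)
    linarith

theorem stmt17 (n : ℕ) (μ : Measure (EuclideanSpace ℝ (Fin n))) [IsProbabilityMeasure μ]
    (hac : μ ≪ volume)
    (h : EuclideanSpace ℝ (Fin n) → ℝ) (L : NNReal) (hLip : LipschitzWith L h)
    (hmean : ∫ x, h x ∂μ = 0)
    (M : ℝ) (hM : M = ⨆ x, |h x|) (hMpos : 0 < M)
    (lam : ℝ) (hlam : 0 < lam)
    (hpoin : lam * ∫ x, (h x) ^ 2 ∂μ ≥ ∫ x, ‖fderiv ℝ h x‖ ^ 2 ∂μ)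
    (ε : ℝ) (hε : 0 < ε) (hε2 : ε < 1 / (2 * M)) :
    (∀ x, 0 < 1 + ε * h x) ∧
    (∫ x, (1 + ε * h x) ∂μ = 1) ∧
    (∫ x, (1 + ε * h x) * Real.log (1 + ε * h x) ∂μ ≥
      (1 - ε * M) / (1 + ε * M) * (1 / (2 * lam)) *
        ∫ x, ‖fderiv ℝ (fun y => 1 + ε * h y) x‖ ^ 2 / (1 + ε * h x) ∂μ) := by
  have hb : BddAbove (range fun x => |h x|) := by
    by_contra hc
    rw [Real.iSup_of_not_bddAbove hc] at hM
    linarith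
  have hle : ∀ x, |h x| ≤ M := fun x => hM ▸ le_ciSup hb x
  have ha : ε * M < 1 / 2 := by
    rw [lt_div_iff₀ (by positivity)] at hε2
    linarith
  have ha0 : 0 < ε * M := by positivity
  set a := ε * M with hadef
  have hup : ∀ x, ε * h x ≤ a := fun x =>
    mul_le_mul_of_nonneg_left (abs_le.1 (hle x)).2 hε.le
  have hlo : ∀ x, -a ≤ ε * h x := fun x => by
    have := mul_le_mul_of_nonneg_left (abs_le.1 (hle x)).1 hε.le
    rw [hadef]; linarith
  have hpos : ∀ x, 0 < 1 + ε * h x := fun x => by linarith [hlo x]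
  have hc : Continuous h := hLip.continuous
  have hint : Integrable h μ :=
    Integrable.of_bound hc.aestronglyMeasurable M (.of_forall fun x => hle x)
  have hint2 : Integrable (fun x => h x ^ 2) μ := by
    refine Integrable.of_bound (hc.pow 2).aestronglyMeasurable (M ^ 2) (.of_forall fun x => ?_)
    rw [norm_pow]
    exact pow_le_pow_left₀ (norm_nonneg _) (hle x) 2
  have hintD : Integrable (fun x => ‖fderiv ℝ h x‖ ^ 2) μ := by
    refine Integrable.of_bound
      ((measurable_fderiv ℝ h).norm.pow_const 2).aestronglyMeasurable ((L : ℝ) ^ 2)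
      (.of_forall fun x => ?_)
    rw [norm_pow, norm_norm]
    exact pow_le_pow_left₀ (norm_nonneg _) (norm_fderiv_le_of_lipschitz ℝ hLip) 2
  have hintF : Integrable (fun x => (1 + ε * h x) * Real.log (1 + ε * h x)) μ := by
    have hcf : Continuous fun x => 1 + ε * h x := by fun_prop
    refine Integrable.of_bound
      (hcf.mul (hcf.log fun x => (hpos x).ne')).aestronglyMeasurable 1
      (.of_forall fun x => ?_)
    have h1 := aux_ineq (ε * h x) a ha0.le (by linarith [hlo x]) (hup x)
    have h2 : 0 ≤ (ε * h x) ^ 2 / (2 * (1 + a)) := by positivity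
    have h3 := Real.log_le_sub_one_of_pos (hpos x)
    have h4 := mul_le_mul_of_nonneg_left h3 (hpos x).le
    rw [Real.norm_eq_abs, abs_le]
    constructor
    · linarith [hlo x]
    · nlinarith [hlo x, hup x]
  refine ⟨hpos, ?_, ?_⟩
  · rw [integral_add (integrable_const _) (hint.const_mul _), integral_const_mul, hmean]
    simp
  have hfd : ∀ x, ‖fderiv ℝ (fun y => 1 + ε * h y) x‖ ^ 2 = ε ^ 2 * ‖fderiv ℝ h x‖ ^ 2 := by
    intro x
    have : fderiv ℝ (fun y => 1 + ε * h y) x = ε • fderiv ℝ h x := by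
      rw [fderiv_const_add]
      exact congrFun (fderiv_const_smul_field (𝕜 := ℝ) (f := h) ε) x
    rw [this, norm_smul, mul_pow, Real.norm_eq_abs, sq_abs]
  have hI : ∫ x, ‖fderiv ℝ (fun y => 1 + ε * h y) x‖ ^ 2 / (1 + ε * h x) ∂μ ≤
      ε ^ 2 / (1 - a) * ∫ x, ‖fderiv ℝ h x‖ ^ 2 ∂μ := by
    rw [← integral_const_mul]
    refine integral_mono_of_nonneg (.of_forall fun x => ?_) (hintD.const_mul _)
      (.of_forall fun x => ?_)
    · have := hpos x
      show 0 ≤ _ / _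
      positivity
    · show _ / _ ≤ ε ^ 2 / (1 - a) * ‖fderiv ℝ h x‖ ^ 2
      rw [hfd, div_mul_eq_mul_div]
      exact div_le_div_of_nonneg_left (by positivity) (by linarith) (by linarith [hlo x])
  have hF : ε ^ 2 / (2 * (1 + a)) * ∫ x, h x ^ 2 ∂μ ≤
      ∫ x, (1 + ε * h x) * Real.log (1 + ε * h x) ∂μ := by
    have e : ∫ x, (ε * h x + ε ^ 2 / (2 * (1 + a)) * h x ^ 2) ∂μ =
        ε ^ 2 / (2 * (1 + a)) * ∫ x, h x ^ 2 ∂μ := by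
      rw [integral_add (hint.const_mul _) (hint2.const_mul _), integral_const_mul,
        integral_const_mul, hmean]
      simp
    rw [← e]
    refine integral_mono ((hint.const_mul _).add (hint2.const_mul _)) hintF fun x => ?_
    have h1 := aux_ineq (ε * h x) a ha0.le (by linarith [hlo x]) (hup x)
    have e2 : (ε * h x) ^ 2 / (2 * (1 + a)) = ε ^ 2 / (2 * (1 + a)) * h x ^ 2 := by ring
    rw [e2] at h1
    exact h1
  have h1a : 0 < 1 - a := by linarith
  have hk : 0 ≤ (1 - a) / (1 + a) * (1 / (2 * lam)) := by positivity
  have s1 := mul_le_mul_of_nonneg_left hI hk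
  have hk2 : 0 ≤ ε ^ 2 / (2 * (1 + a)) / lam := by positivity
  have s2 := mul_le_mul_of_nonneg_left hpoin hk2
  have e1 : ∀ D : ℝ, (1 - a) / (1 + a) * (1 / (2 * lam)) * (ε ^ 2 / (1 - a) * D) =
      ε ^ 2 / (2 * (1 + a)) / lam * D := by
    intro D
    field_simp
  have e2 : ∀ D : ℝ, ε ^ 2 / (2 * (1 + a)) / lam * (lam * D) = ε ^ 2 / (2 * (1 + a)) * D := by
    intro D
    field_simp
  rw [e1] at s1
  rw [e2] at s2
  exact (s1.trans s2).trans hF
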